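/- Let I be the radical ideal of r ≥ 1 distinct points of K^n (n ≥ 1) and let γ(I) = lim_{m→∞} α(I^m)/m (which exists). Then γ(I) ≤ r^{1/n}. Moreover, if 1 ≤ r ≤ n then γ(I) = 1. -/

import Mathlib

open MvPolynomial Filter
open scoped Classical

noncomputable section

/-- The (maximal) ideal of polynomials vanishing at the point `p` of affine `n`-space. -/
def pointIdeal {n : ℕ} (K : Type*) [Field K] (p : Fin n → K) :
    Ideal (MvPolynomial (Fin n) K) :=
  RingHom.ker (MvPolynomial.eval p)

/-- The homogeneous ideal generated by the forms vanishing at (a representative of) a point of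
projective space. -/
def projPointIdeal {N : ℕ} (K : Type*) [Field K] (p : Fin N → K) :
    Ideal (MvPolynomial (Fin N) K) :=
  Ideal.span { f | (∃ d, f.IsHomogeneous d) ∧ MvPolynomial.eval p f = 0 }

/-- `α(I)`: the least degree of a nonzero element of `I`. -/
def alphaDeg {σ K : Type*} [Field K] (I : Ideal (MvPolynomial σ K)) : ℕ :=
  sInf { d | ∃ f ∈ I, f ≠ 0 ∧ f.totalDegree = d }

/-- `H^≤_I(t) = dim_K I_{≤ t}`. -/
def hilbLe {n : ℕ} (K : Type*) [Field K] (I : Ideal (MvPolynomial (Fin n) K)) (t : ℕ) : ℕ :=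
  Module.finrank K
    ↥(Submodule.restrictScalars K I ⊓ MvPolynomial.restrictTotalDegree (Fin n) K t)

/-- `H_{R/I}(t) = dim_K R_t/I_t = dim_K R_t - dim_K I_t`. -/
def hilbProj {N : ℕ} (K : Type*) [Field K] (I : Ideal (MvPolynomial (Fin N) K)) (t : ℕ) : ℕ :=
  Module.finrank K ↥(MvPolynomial.homogeneousSubmodule (Fin N) K t) -
    Module.finrank K
      ↥(Submodule.restrictScalars K I ⊓ MvPolynomial.homogeneousSubmodule (Fin N) K t)

/-- The exponent vectors of total degree less than `m`. -/
def expsLT (n m : ℕ) : Finset (Fin n →₀ ℕ) :=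
  (Finset.range m).biUnion fun i => Finset.univ.finsuppAntidiag i

lemma mem_expsLT {n m : ℕ} {x : Fin n →₀ ℕ} : x ∈ expsLT n m ↔ x.degree < m := by
  simp [expsLT, Finset.mem_finsuppAntidiag, Finsupp.degree_eq_sum]

lemma card_expsLT_succ (n k : ℕ) : (expsLT n (k + 1)).card = (n + k).choose n := by
  rw [expsLT, Finset.card_biUnion]
  · simp only [Finset.card_finsuppAntidiag_nat_eq_multichoose, Finset.card_univ, Fintype.card_fin]
    rw [Nat.sum_range_multichoose, add_comm]
  · intro i _ j _ hij
    rw [Function.onFun, Finset.disjoint_left]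
    intro x hx hy
    rw [Finset.mem_finsuppAntidiag] at hx hy
    exact hij (hx.1.symm.trans hy.1)

section

variable {K : Type*} [Field K] {n : ℕ}

lemma finrank_restrictTotalDegree (t : ℕ) :
    Module.finrank K (restrictTotalDegree (Fin n) K t) = (n + t).choose n := by
  have h : { x : Fin n →₀ ℕ | (x.sum fun _ e => e) ≤ t } = expsLT n (t + 1) := by
    ext x
    rw [Finset.mem_coe, mem_expsLT, Nat.lt_succ_iff]
    rfl
  rw [restrictTotalDegree, Module.finrank_eq_nat_card_basis (basisRestrictSupport K _), h,
    ← card_expsLT_succ]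
  simp

/-- The substitution `x ↦ x + p`. -/
def translateHom (p : Fin n → K) : MvPolynomial (Fin n) K →ₐ[K] MvPolynomial (Fin n) K :=
  aeval fun i => X i + C (p i)

lemma translate_neg_translate (p : Fin n → K) (f : MvPolynomial (Fin n) K) :
    translateHom (-p) (translateHom p f) = f := by
  suffices h : (translateHom (-p)).comp (translateHom p) = AlgHom.id K _ from DFunLike.congr_fun h f
  ext i
  simp [translateHom]

lemma translate_injective (p : Fin n → K) : Function.Injective (translateHom p) :=
  Function.LeftInverse.injective (translate_neg_translate p)

lemma totalDegree_translate_le (p : Fin n → K) (f : MvPolynomial (Fin n) K) :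
    (translateHom p f).totalDegree ≤ f.totalDegree := by
  rw [translateHom, aeval_def, eval₂_eq]
  refine totalDegree_finsetSum_le fun d hd => ?_
  refine (totalDegree_mul _ _).trans ?_
  rw [algebraMap_eq, totalDegree_C, zero_add]
  refine (totalDegree_finsetProd _ _).trans (le_trans ?_ (le_totalDegree hd))
  refine Finset.sum_le_sum fun i _ => (totalDegree_pow _ _).trans ?_
  have h : (X i + C (p i) : MvPolynomial (Fin n) K).totalDegree ≤ 1 :=
    (totalDegree_add _ _).trans (by simp)
  simpa using Nat.mul_le_mul_left (d i) h

lemma map_translate_pointIdeal_le (p : Fin n → K) :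
    (pointIdeal K p).map (translateHom p) ≤ idealOfVars (Fin n) K := by
  rw [Ideal.map_le_iff_le_comap]
  intro f hf
  have h : constantCoeff (translateHom p f) = eval p f := by
    have : constantCoeff.comp (translateHom p).toRingHom = eval p := by
      ext <;> simp [translateHom]
    exact DFunLike.congr_fun this f
  rw [Ideal.mem_comap, ← pow_one (idealOfVars _ _), mem_pow_idealOfVars_iff']
  intro x hx
  rw [Nat.lt_one_iff, Finsupp.degree_eq_zero_iff] at hx
  rw [hx, ← constantCoeff_eq, h]
  exact hf

lemma map_translate_neg_idealOfVars_le (p : Fin n → K) :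
    (idealOfVars (Fin n) K).map (translateHom (-p)) ≤ pointIdeal K p := by
  rw [idealOfVars, Ideal.map_span, Ideal.span_le]
  rintro _ ⟨_, ⟨i, rfl⟩, rfl⟩
  simp [translateHom, pointIdeal]

lemma mem_pointIdeal_pow_iff (p : Fin n → K) (m : ℕ) (f : MvPolynomial (Fin n) K) :
    f ∈ pointIdeal K p ^ m ↔ ∀ x, x.degree < m → (translateHom p f).coeff x = 0 := by
  rw [← mem_pow_idealOfVars_iff']
  constructor
  · intro hf
    have := Ideal.mem_map_of_mem (translateHom p) hf
    rw [Ideal.map_pow] at this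
    exact Ideal.pow_right_mono (map_translate_pointIdeal_le p) m this
  · intro hf
    have := Ideal.mem_map_of_mem (translateHom (-p)) hf
    rw [Ideal.map_pow, translate_neg_translate] at this
    exact Ideal.pow_right_mono (map_translate_neg_idealOfVars_le p) m this

lemma le_totalDegree_of_mem_pointIdeal_pow {p : Fin n → K} {m : ℕ} {f : MvPolynomial (Fin n) K}
    (hf : f ∈ pointIdeal K p ^ m) (h0 : f ≠ 0) : m ≤ f.totalDegree := by
  obtain ⟨x, hx⟩ := exists_coeff_ne_zero ((map_ne_zero_iff _ (translate_injective p)).2 h0)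
  have hm : m ≤ x.degree := by
    by_contra! h
    exact hx ((mem_pointIdeal_pow_iff p m f).1 hf x h)
  exact hm.trans ((le_totalDegree (mem_support_iff.2 hx)).trans (totalDegree_translate_le p f))

lemma pointIdeal_isMaximal (p : Fin n → K) : (pointIdeal K p).IsMaximal :=
  RingHom.ker_isMaximal_of_surjective _ fun c => ⟨C c, eval_C c⟩

lemma pointIdeal_injective : Function.Injective (pointIdeal (n := n) K) := by
  intro p q h
  funext i
  have hp : X i - C (p i) ∈ pointIdeal K p := by simp [pointIdeal]
  rw [h] at hp
  simpa [pointIdeal, sub_eq_zero, eq_comm] using hp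

lemma iInf_pointIdeal_pow_le {r : ℕ} {p : Fin r → Fin n → K} (hp : Function.Injective p) (m : ℕ) :
    ⨅ i, pointIdeal K (p i) ^ m ≤ (⨅ i, pointIdeal K (p i)) ^ m := by
  have hc : ((Finset.univ : Finset (Fin r)) : Set (Fin r)).Pairwise
      (Function.onFun IsCoprime fun i => pointIdeal K (p i) ^ m) := by
    intro i _ j _ hij
    have := pointIdeal_isMaximal (p i)
    have := pointIdeal_isMaximal (p j)
    exact (Ideal.isCoprime_of_isMaximal fun h => hij (hp (pointIdeal_injective h))).pow
  have h := Ideal.prod_eq_iInf_of_pairwise_isCoprime hc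
  simp only [Finset.mem_univ, iInf_pos] at h
  rw [← h, Finset.prod_pow]
  refine Ideal.pow_right_mono (le_iInf fun i => ?_) m
  exact Ideal.prod_le_inf.trans (Finset.inf_le (Finset.mem_univ i))

/-- Counting conditions: vanishing to order `k + 1` at `r` points imposes at most
`r * (n + k).choose n` linear conditions. -/
lemma exists_mem_pow_totalDegree_le {r : ℕ} {p : Fin r → Fin n → K} (hp : Function.Injective p)
    {k t : ℕ} (h : r * (n + k).choose n < (n + t).choose n) :
    ∃ f ∈ (⨅ i, pointIdeal K (p i)) ^ (k + 1), f ≠ 0 ∧ f.totalDegree ≤ t := by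
  let L : restrictTotalDegree (Fin n) K t →ₗ[K] Fin r × expsLT n (k + 1) → K :=
    LinearMap.pi fun q => lcoeff K q.2.1 ∘ₗ (translateHom (p q.1)).toLinearMap ∘ₗ Submodule.subtype _
  have hL : LinearMap.ker L ≠ ⊥ := by
    apply LinearMap.ker_ne_bot_of_finrank_lt
    rw [finrank_restrictTotalDegree, Module.finrank_fintype_fun_eq_card, Fintype.card_prod,
      Fintype.card_fin, Fintype.card_coe, card_expsLT_succ]
    exact h
  obtain ⟨f, hf, h0⟩ := Submodule.exists_mem_ne_zero_of_ne_bot hL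
  refine ⟨f, iInf_pointIdeal_pow_le hp _ ?_, by simpa using h0,
    (mem_restrictTotalDegree _ _ _).1 f.2⟩
  rw [Ideal.mem_iInf]
  intro i
  rw [mem_pointIdeal_pow_iff]
  intro x hx
  exact congrFun (LinearMap.mem_ker.1 hf) (i, ⟨x, mem_expsLT.2 hx⟩)

end

section alphaDeg

variable {σ K : Type*} [Field K]

lemma alphaDeg_le {I : Ideal (MvPolynomial σ K)} {f : MvPolynomial σ K} (hf : f ∈ I)
    (h0 : f ≠ 0) : alphaDeg I ≤ f.totalDegree :=
  Nat.sInf_le ⟨f, hf, h0, rfl⟩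

lemma exists_totalDegree_eq_alphaDeg {I : Ideal (MvPolynomial σ K)} (hI : I ≠ ⊥) :
    ∃ f ∈ I, f ≠ 0 ∧ f.totalDegree = alphaDeg I := by
  obtain ⟨f, hf, h0⟩ := Submodule.exists_mem_ne_zero_of_ne_bot hI
  exact Nat.sInf_mem (s := { d | ∃ f ∈ I, f ≠ 0 ∧ f.totalDegree = d }) ⟨_, f, hf, h0, rfl⟩

lemma alphaDeg_mul_le {I J : Ideal (MvPolynomial σ K)} (hI : I ≠ ⊥) (hJ : J ≠ ⊥) :
    alphaDeg (I * J) ≤ alphaDeg I + alphaDeg J := by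
  obtain ⟨f, hf, hf0, hfd⟩ := exists_totalDegree_eq_alphaDeg hI
  obtain ⟨g, hg, hg0, hgd⟩ := exists_totalDegree_eq_alphaDeg hJ
  rw [← hfd, ← hgd]
  exact (alphaDeg_le (Ideal.mul_mem_mul hf hg) (mul_ne_zero hf0 hg0)).trans (totalDegree_mul f g)

end alphaDeg

/-- The numerical estimate behind `γ(I) ≤ r^{1/n}`. -/
lemma mul_choose_lt_choose_floor {n : ℕ} (hn : n ≠ 0) (r k : ℕ) :
    r * (n + k).choose n <
      (n + ⌊(r : ℝ) ^ ((1 : ℝ) / (n : ℝ)) * (k + n : ℕ)⌋₊).choose n := by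
  set c : ℝ := (r : ℝ) ^ ((1 : ℝ) / (n : ℝ)) with hc
  set t := ⌊c * (k + n : ℕ)⌋₊
  have hc0 : 0 ≤ c := by positivity
  have hcn : c ^ n = r := by
    rw [hc, one_div]
    exact Real.rpow_inv_natCast_pow (Nat.cast_nonneg r) hn
  have hlt : r * (k + n) ^ n < (t + 1) ^ n := by
    have h : (c * (k + n : ℕ)) ^ n < ((t : ℝ) + 1) ^ n :=
      pow_lt_pow_left₀ (Nat.lt_floor_add_one _) (by positivity) hn
    rw [mul_pow, hcn] at h
    exact_mod_cast h
  have h1 := Nat.ascFactorial_le_pow_add k n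
  have h2 := Nat.pow_succ_le_ascFactorial (t + 1) n
  rw [Nat.ascFactorial_eq_factorial_mul_choose] at h1 h2
  rw [add_comm n k, add_comm n t]
  refine Nat.lt_of_mul_lt_mul_left (a := n.factorial) ?_
  calc n.factorial * (r * (k + n).choose n) = r * (n.factorial * (k + n).choose n) := by ring
    _ ≤ r * (k + n) ^ n := Nat.mul_le_mul_left r h1
    _ < (t + 1) ^ n := hlt
    _ ≤ _ := h2

/-- for the radical ideal `I` of `r ≥ 1` distinct points of `K^n`,
`γ(I) = lim α(I^m)/m` exists, is at most `r^{1/n}`, and equals `1` when `r ≤ n`. -/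
theorem stmt_2 {K : Type*} [Field K] [IsAlgClosed K]
    (n r : ℕ) (hn : 1 ≤ n) (hr : 1 ≤ r)
    (p : Fin r → (Fin n → K)) (hp : Function.Injective p)
    (I : Ideal (MvPolynomial (Fin n) K)) (hI : I = ⨅ i, pointIdeal K (p i)) :
    ∃ γ : ℝ,
      Filter.Tendsto (fun m : ℕ => (alphaDeg (I ^ m) : ℝ) / m) Filter.atTop (nhds γ) ∧
      γ ≤ (r : ℝ) ^ ((1 : ℝ) / (n : ℝ)) ∧
      (r ≤ n → γ = 1) := by
  subst hI
  have hn0 : n ≠ 0 := by omega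
  set I := ⨅ i, pointIdeal K (p i)
  set c : ℝ := (r : ℝ) ^ ((1 : ℝ) / (n : ℝ))
  have hc0 : 0 ≤ c := by positivity
  have hub (k : ℕ) : (alphaDeg (I ^ (k + 1)) : ℝ) ≤ c * (k + n : ℕ) := by
    obtain ⟨f, hf, h0, hd⟩ :=
      exists_mem_pow_totalDegree_le hp (mul_choose_lt_choose_floor hn0 r k)
    exact (Nat.le_floor_iff (by positivity)).1 ((alphaDeg_le hf h0).trans hd)
  have hI0 : I ≠ ⊥ := by
    obtain ⟨f, hf, h0, -⟩ :=
      exists_mem_pow_totalDegree_le hp (mul_choose_lt_choose_floor hn0 r 0)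
    rw [zero_add, pow_one] at hf
    exact fun h => h0 (Ideal.mem_bot.1 (h.le hf))
  have hpow (m : ℕ) : I ^ m ≠ ⊥ := pow_ne_zero m hI0
  have hlb (m : ℕ) : m ≤ alphaDeg (I ^ m) := by
    obtain ⟨f, hf, h0, hd⟩ := exists_totalDegree_eq_alphaDeg (hpow m)
    rw [← hd]
    exact le_totalDegree_of_mem_pointIdeal_pow
      (Ideal.pow_right_mono (iInf_le _ (⟨0, hr⟩ : Fin r)) m hf) h0
  have hsub : Subadditive fun m : ℕ => (alphaDeg (I ^ m) : ℝ) := by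
    intro a b
    simp only [pow_add]
    exact_mod_cast alphaDeg_mul_le (hpow a) (hpow b)
  have hlim := hsub.tendsto_lim
    ⟨0, by rintro _ ⟨m, rfl⟩; positivity⟩
  refine ⟨hsub.lim, hlim, ?_, fun hrn => ?_⟩
  · have hinv : Tendsto (fun k : ℕ => 1 / ((k : ℝ) + 1)) atTop (nhds 0) :=
      tendsto_one_div_add_atTop_nhds_zero_nat
    have hb : Tendsto (fun k : ℕ => c + c * (n - 1) * (1 / ((k : ℝ) + 1))) atTop (nhds c) := by
      simpa using (hinv.const_mul (c * (n - 1))).const_add c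
    refine le_of_tendsto_of_tendsto' (hlim.comp (tendsto_add_atTop_nat 1)) hb fun k => ?_
    have hk : (0 : ℝ) < k + 1 := by positivity
    simp only [Function.comp_apply]
    push_cast
    rw [div_le_iff₀ hk]
    refine (hub k).trans (le_of_eq ?_)
    push_cast
    field_simp
    ring
  · have hα (m : ℕ) : alphaDeg (I ^ m) ≤ m := by
      obtain ⟨f, hf, h0, hd⟩ := exists_mem_pow_totalDegree_le (K := K) (k := 0) (t := 1) hp
        (by simpa using Nat.lt_succ_of_le hrn)
      rw [zero_add, pow_one] at hf
      refine (alphaDeg_le (Ideal.pow_mem_pow hf m) (pow_ne_zero m h0)).trans ?_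
      refine (totalDegree_pow f m).trans ?_
      simpa using Nat.mul_le_mul_left m hd
    refine tendsto_nhds_unique hlim (tendsto_const_nhds.congr' ?_)
    filter_upwards [eventually_ne_atTop 0] with m hm
    rw [(hα m).antisymm (hlb m), div_self (Nat.cast_ne_zero.2 hm)]
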